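/- Let A be a C*-algebra and let a, b ∈ A with 0 ≤ a ≤ 1 and 0 ≤ b ≤ 1. Suppose there is x ∈ A such that x*x = a and xx* ∈ Her(b). Then for every ε > 0 there exists a unitary U in M₂(Ã) such that U* · diag(f_ε(a), 0) · U lies in the hereditary C*-subalgebra of M₂(A) generated by diag(b, 0), i.e. in the norm closure of { diag(b,0) · m · diag(b,0) : m ∈ M₂(A) }. -/

import Mathlib

/-- The cut-off function `f_ε : ℝ → ℝ`: it is `0` on `(-∞, ε/2]`, `1` on `[ε, ∞)`,
and linear on `[ε/2, ε]` (for `ε > 0`). -/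
noncomputable def fcut (ε : ℝ) : ℝ → ℝ := fun t => min 1 (max 0 ((t - ε / 2) / (ε / 2)))

/-- The Halmos unitary dilation `!![y⋆, c; d, -y]` compresses `diag(f, 0)` to `diag(y f y⋆, 0)`
when `c f = f c = 0`. -/
lemma exists_unitary_conj_diagonal {B : Type*} [Ring B] [StarRing B] {y c d f : B}
    (hc : star c = c) (hd : star d = d) (hyc : star y * y + c * c = 1)
    (hyd : y * star y + d * d = 1) (hcd : y * c = d * y) (hcf : c * f = 0) (hfc : f * c = 0) :
    ∃ U : Matrix (Fin 2) (Fin 2) B, star U * U = 1 ∧ U * star U = 1 ∧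
      star U * Matrix.diagonal ![f, 0] * U = Matrix.diagonal ![y * f * star y, 0] := by
  have hcd' : c * star y = star y * d := by
    simpa [hc, hd] using congrArg star hcd
  have hU : star !![star y, c; d, -y] = !![y, d; c, -star y] := by
    ext i j
    fin_cases i <;> fin_cases j <;> simp [Matrix.star_apply, hc, hd]
  refine ⟨!![star y, c; d, -y], ?_, ?_, ?_⟩
  · rw [hU, Matrix.mul_fin_two, Matrix.one_fin_two]
    simp [hyd, hcd, hcd', add_comm (c * c), hyc]
  · rw [hU, Matrix.mul_fin_two, Matrix.one_fin_two]
    simp [hyc, hcd, hcd', add_comm (d * d), hyd]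
  · have hD (p : B) : Matrix.diagonal ![p, 0] = !![p, 0; 0, 0] := by
      ext i j
      fin_cases i <;> fin_cases j <;> simp
    rw [hU, hD, hD, Matrix.mul_fin_two, Matrix.mul_fin_two]
    simp [hcf, mul_assoc, hfc]

lemma continuous_fcut (ε : ℝ) : Continuous (fcut ε) := by
  unfold fcut
  fun_prop

lemma fcut_nonneg (ε t : ℝ) : 0 ≤ fcut ε t :=
  le_min zero_le_one (le_max_left _ _)

lemma fcut_le_one (ε t : ℝ) : fcut ε t ≤ 1 :=
  min_le_left _ _

lemma fcut_eq_zero {ε t : ℝ} (hε : 0 < ε) (ht : t ≤ ε / 2) : fcut ε t = 0 := by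
  have : (t - ε / 2) / (ε / 2) ≤ 0 :=
    div_nonpos_of_nonpos_of_nonneg (by linarith) (by linarith)
  simp [fcut, max_eq_left this]

lemma fcut_eq_one {ε t : ℝ} (hε : 0 < ε) (ht : ε ≤ t) : fcut ε t = 1 := by
  have : 1 ≤ (t - ε / 2) / (ε / 2) := by
    rw [le_div_iff₀ (by linarith)]
    linarith
  exact min_eq_left (this.trans (le_max_right _ _))

lemma fcut_half_mul_fcut {ε : ℝ} (hε : 0 < ε) (t : ℝ) :
    fcut (ε / 2) t * fcut ε t = fcut ε t := by
  rcases le_total t (ε / 2) with h | h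
  · simp [fcut_eq_zero hε h]
  · simp [fcut_eq_one (half_pos hε) h]

/-- The functional calculus elements entering the Halmos dilation of the partial isometry in the
polar decomposition of an element `x` with `x⋆ x = a`, cut off near zero. -/
lemma exists_cutoff_elements {A : Type*} [NonUnitalCStarAlgebra A] {a : A}
    (ha : IsSelfAdjoint a) {ε : ℝ} (hε : 0 < ε) :
    ∃ R K Q : A, IsSelfAdjoint R ∧ IsSelfAdjoint K ∧ Commute a R ∧ Commute a K ∧ Commute K R ∧
      K * K = 2 • R - R * a * R ∧
      a * R * cfcₙ (fcut ε) a = cfcₙ (fcut ε) a ∧ cfcₙ (fcut ε) a * (a * R) = cfcₙ (fcut ε) a ∧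
      K * cfcₙ (fcut ε) a * K = a * Q * a := by
  set φ := fcut (ε / 2) with hφ
  set m : ℝ → ℝ := fun t => max t (ε / 4) with hm
  have hm0 (t : ℝ) : m t ≠ 0 := (lt_max_of_lt_right (by linarith : (0 : ℝ) < ε / 4)).ne'
  have hmpos (t : ℝ) : 0 ≤ m t := le_max_of_le_right (by linarith)
  have hmc : Continuous m := by fun_prop
  have hφc : Continuous φ := continuous_fcut _
  have hfc : Continuous (fcut ε) := continuous_fcut _
  have hφ0 : φ 0 = 0 := fcut_eq_zero (half_pos hε) (by linarith)
  have hf0 : fcut ε 0 = 0 := fcut_eq_zero hε (by linarith)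
  have hφm (t : ℝ) : t * φ t = m t * φ t := by
    rcases le_total t (ε / 4) with h | h
    · simp [hφ, fcut_eq_zero (half_pos hε) (by linarith : t ≤ ε / 2 / 2)]
    · simp [hm, max_eq_left h]
  have hφf (t : ℝ) : φ t * fcut ε t = fcut ε t := fcut_half_mul_fcut hε t
  set r : ℝ → ℝ := fun t => φ t / m t with hr
  set k : ℝ → ℝ := fun t => √(φ t * (2 - φ t) / m t) with hk
  set q : ℝ → ℝ := fun t => fcut ε t / m t ^ 3 with hq
  have hrc : Continuous r := hφc.div hmc hm0
  have hkc : Continuous k := ((hφc.mul (continuous_const.sub hφc)).div hmc hm0).sqrt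
  have hqc : Continuous q := hfc.div (hmc.pow 3) fun t => pow_ne_zero 3 (hm0 t)
  have hr0 : r 0 = 0 := by simp [hr, hφ0]
  have hk0 : k 0 = 0 := by simp [hk, hφ0]
  have hq0 : q 0 = 0 := by simp [hq, hf0]
  have hkk (t : ℝ) : k t * k t = φ t * (2 - φ t) / m t :=
    Real.mul_self_sqrt (div_nonneg (mul_nonneg (fcut_nonneg _ _)
      (by linarith [fcut_le_one (ε / 2) t])) (hmpos t))
  have htr (t : ℝ) : t * r t = φ t := by
    have := hm0 t
    simp only [hr]
    rw [mul_div_assoc', hφm]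
    field_simp
  have mul {g h : ℝ → ℝ} (hg : Continuous g) (hg0 : g 0 = 0) (hh : Continuous h)
      (hh0 : h 0 = 0) : cfcₙ g a * cfcₙ h a = cfcₙ (fun t => g t * h t) a :=
    (cfcₙ_mul g h a hg.continuousOn hg0 hh.continuousOn hh0).symm
  have hid : cfcₙ (fun t : ℝ => t) a = a := cfcₙ_id' ℝ a
  have haR : a * cfcₙ r a = cfcₙ φ a := by
    rw [← funext htr, ← mul continuous_id' rfl hrc hr0, hid]
  have hcomm (g : ℝ → ℝ) : Commute a (cfcₙ g a) := by
    simpa only [hid] using cfcₙ_commute_cfcₙ (fun t : ℝ => t) g a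
  refine ⟨cfcₙ r a, cfcₙ k a, cfcₙ q a, cfcₙ_predicate r a, cfcₙ_predicate k a,
    hcomm r, hcomm k, cfcₙ_commute_cfcₙ k r a, ?_, ?_, ?_, ?_⟩
  · rw [mul_assoc, haR, mul hkc hk0 hkc hk0, mul hrc hr0 hφc hφ0,
      ← cfcₙ_smul 2 r a hrc.continuousOn hr0,
      ← cfcₙ_sub (fun t => 2 • r t) (fun t => r t * φ t) a (hrc.const_smul 2).continuousOn (by simp [hr0])
        (hrc.mul hφc).continuousOn (by simp [hr0])]
    congr 1
    ext t
    rw [hkk]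
    simp only [hr, nsmul_eq_mul]
    push_cast
    ring
  · rw [haR, mul hφc hφ0 hfc hf0, funext hφf]
  · rw [haR, mul hfc hf0 hφc hφ0]
    simp only [mul_comm (fcut ε _), hφf]
  · rw [mul hkc hk0 hfc hf0, mul (g := fun t => k t * fcut ε t) (hkc.mul hfc) (by simp [hf0]) hkc hk0]
    have haq : a * cfcₙ q a * a = cfcₙ (fun t => t * q t * t) a := by
      rw [← mul (g := fun t => t * q t) (continuous_id'.mul hqc) (by simp) continuous_id' rfl,
        ← mul continuous_id' rfl hqc hq0, hid]
    rw [haq]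
    congr 1
    ext t
    have hmt := hm0 t
    have h1 : k t * fcut ε t * k t = fcut ε t / m t := by
      have h2 : k t * fcut ε t * k t = k t * k t * fcut ε t := by ring
      rw [h2, hkk]
      have h3 : φ t * (2 - φ t) * fcut ε t = fcut ε t := by
        linear_combination (2 - φ t) * hφf t - hφf t
      rw [div_mul_eq_mul_div, h3]
    have h4 : t * fcut ε t = m t * fcut ε t := by
      linear_combination fcut ε t * hφm t - (t - m t) * hφf t
    rw [h1]
    simp only [hq]
    field_simp
    linear_combination -(t + m t) * h4

/-- The hereditary subalgebra generated by `b` absorbs products `h z h` with `h` in it. -/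
lemma conj_mem_closure_conj {A : Type*} [NonUnitalCStarAlgebra A] {b h : A}
    (hh : h ∈ closure {y : A | ∃ z : A, y = b * z * b}) (z : A) :
    h * z * h ∈ closure {y : A | ∃ z : A, y = b * z * b} := by
  refine map_mem_closure (f := fun h => h * z * h) (by fun_prop) hh ?_
  rintro _ ⟨w, rfl⟩
  exact ⟨w * b * z * b * w, by simp only [mul_assoc]⟩

/-- The corner embedding maps the hereditary subalgebra generated by `b` into the one generated
by `diag(b, 0)`. -/
lemma diagonal_mem_closure_conj {A : Type*} [NonUnitalCStarAlgebra A] {b h : A}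
    (hh : h ∈ closure {y : A | ∃ z : A, y = b * z * b}) :
    Matrix.diagonal ![(h : Unitization ℂ A), 0] ∈
      closure {w : Matrix (Fin 2) (Fin 2) (Unitization ℂ A) |
        ∃ m : Matrix (Fin 2) (Fin 2) A,
          w = Matrix.diagonal ![((b : A) : Unitization ℂ A), 0] *
                m.map (fun z : A => (z : Unitization ℂ A)) *
              Matrix.diagonal ![((b : A) : Unitization ℂ A), 0]} := by
  have hc : Continuous fun h : A => (h : Unitization ℂ A) :=
    (Unitization.isometry_inr (𝕜 := ℂ) (A := A)).continuous
  refine map_mem_closure (f := fun h : A => Matrix.diagonal ![(h : Unitization ℂ A), 0])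
    ?_ hh ?_
  · refine Continuous.matrix_diagonal (continuous_pi fun i => ?_)
    fin_cases i
    · exact hc
    · exact continuous_const
  · rintro _ ⟨z, rfl⟩
    refine ⟨Matrix.of fun _ _ => z, ?_⟩
    ext1 i j
    fin_cases i <;> fin_cases j <;> simp [Matrix.diagonal_mul, Matrix.mul_diagonal]

/-- Lemma 8.6 of the paper.  Let `a, b` be positive contractions in a
C*-algebra `A` and suppose `x ∈ A` satisfies `x*x = a` and `xx* ∈ Her(b)`.  Then for every
`ε > 0` there is a unitary `U ∈ M₂(Ã)` such that `U* diag(f_ε(a), 0) U` lies in the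
hereditary subalgebra of `M₂(A)` generated by `diag(b, 0)` (viewed inside `M₂(Ã)`),
i.e. in the closure of `{ diag(b,0) m diag(b,0) : m ∈ M₂(A) }`. -/
theorem stmt11 {A : Type*} [NonUnitalCStarAlgebra A] [PartialOrder A] [StarOrderedRing A]
    (a b : A) (ha0 : 0 ≤ a) (ha1 : ‖a‖ ≤ 1) (hb0 : 0 ≤ b) (hb1 : ‖b‖ ≤ 1)
    (x : A) (hx1 : star x * x = a)
    (hx2 : x * star x ∈ closure {y : A | ∃ z : A, y = b * z * b}) :
    ∀ ε > (0 : ℝ), ∃ U : Matrix (Fin 2) (Fin 2) (Unitization ℂ A),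
      star U * U = 1 ∧ U * star U = 1 ∧
      star U * Matrix.diagonal ![((cfcₙ (fcut ε) a : A) : Unitization ℂ A), 0] * U ∈
        closure {w : Matrix (Fin 2) (Fin 2) (Unitization ℂ A) |
          ∃ m : Matrix (Fin 2) (Fin 2) A,
            w = Matrix.diagonal ![((b : A) : Unitization ℂ A), 0] *
                  m.map (fun z : A => (z : Unitization ℂ A)) *
                Matrix.diagonal ![((b : A) : Unitization ℂ A), 0]} := by
  intro ε hε
  obtain ⟨R, K, Q, hR, hK, haR, haK, hKR, hKK, hRf, hfR, hKf⟩ :=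
    exists_cutoff_elements (IsSelfAdjoint.of_nonneg ha0) hε
  set f := cfcₙ (fcut ε) a
  have hyf : x * K * f * star (x * K) = x * star x * (x * Q * star x) * (x * star x) := by
    calc x * K * f * star (x * K) = x * (K * f * K) * star x := by
          simp only [star_mul, hK.star_eq, mul_assoc]
      _ = _ := by
          rw [hKf, ← hx1]
          simp only [mul_assoc]
  have hyy : star (x * K) * (x * K) = 2 • (a * R) - a * R * (a * R) := by
    calc star (x * K) * (x * K) = K * (star x * x) * K := by
          simp only [star_mul, hK.star_eq, mul_assoc]
      _ = a * (K * K) := by rw [hx1, ← haK.eq, mul_assoc]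
      _ = _ := by rw [hKK, mul_sub, mul_smul_comm]; simp only [mul_assoc]
  have hyy' : x * K * star (x * K) =
      2 • (x * R * star x) - x * R * star x * (x * R * star x) := by
    calc x * K * star (x * K) = x * (K * K) * star x := by
          simp only [star_mul, hK.star_eq, mul_assoc]
      _ = _ := by
          rw [hKK, ← hx1, mul_sub, sub_mul, mul_smul_comm, smul_mul_assoc]
          simp only [mul_assoc]
  have hcd : x * K * (a * R) = x * R * star x * (x * K) := by
    calc x * K * (a * R) = x * (K * a * R) := by simp only [mul_assoc]
      _ = x * (R * a * K) := by
          rw [← haK.eq, mul_assoc a, hKR.eq, ← mul_assoc a, haR.eq]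
      _ = _ := by rw [← hx1]; simp only [mul_assoc]
  have hsc : star (a * R) = a * R := by
    rw [star_mul, hR.star_eq, (IsSelfAdjoint.of_nonneg ha0).star_eq, haR.eq]
  have hsd : star (x * R * star x) = x * R * star x := by
    simp only [star_mul, star_star, hR.star_eq, mul_assoc]
  have hone (p : A) : ((2 • p - p * p : A) : Unitization ℂ A) +
      (1 - (p : Unitization ℂ A)) * (1 - (p : Unitization ℂ A)) = 1 := by
    rw [Unitization.inr_sub, Unitization.inr_smul, Unitization.inr_mul]
    noncomm_ring
  obtain ⟨U, hU, hU', hUf⟩ := exists_unitary_conj_diagonal (B := Unitization ℂ A)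
    (y := ((x * K : A) : Unitization ℂ A)) (c := 1 - ((a * R : A) : Unitization ℂ A))
    (d := 1 - ((x * R * star x : A) : Unitization ℂ A)) (f := (f : Unitization ℂ A))
    (by rw [star_sub, star_one, ← Unitization.inr_star, hsc])
    (by rw [star_sub, star_one, ← Unitization.inr_star, hsd])
    (by rw [← Unitization.inr_star, ← Unitization.inr_mul, hyy, hone])
    (by rw [← Unitization.inr_star, ← Unitization.inr_mul, hyy', hone])
    (by rw [mul_sub, sub_mul, mul_one, one_mul, ← Unitization.inr_mul, hcd,
      ← Unitization.inr_mul])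
    (by rw [sub_mul, one_mul, ← Unitization.inr_mul, hRf, sub_self])
    (by rw [mul_sub, mul_one, ← Unitization.inr_mul, hfR, sub_self])
  refine ⟨U, hU, hU', ?_⟩
  rw [hUf, ← Unitization.inr_star, ← Unitization.inr_mul, ← Unitization.inr_mul, hyf]
  exact diagonal_mem_closure_conj (conj_mem_closure_conj hx2 _)
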